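/- arXiv:1602.03054 — 2 statements merged into one kernel-verified Lean document; each statement's English description precedes it below -/
import Mathlib

section
/- The conformal gluing function w is injective on the domain G_R, i.e. for all θ, θ′ ∈ G_R, w(θ) = w(θ′) implies θ = θ′. -/
/-- The cut plane `ℂ ∖ (−∞, −1]`. -/
def cutC : Set ℂ := {z : ℂ | z.im = 0 ∧ z.re ≤ -1}ᶜ

/-- `T` is an analytic function on the cut plane `ℂ ∖ (−∞, −1]` agreeing with
`x ↦ cos (a · arccos x)` on `(−1, 1]`. -/
def IsChebyshev (a : ℝ) (T : ℂ → ℂ) : Prop :=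
  (∀ z ∈ cutC, DifferentiableAt ℂ T z) ∧
  ∀ x : ℝ, x ∈ Set.Ioc (-1 : ℝ) 1 → T (x : ℂ) = ((Real.cos (a * Real.arccos x) : ℝ) : ℂ)

/-- The affine map `χ(θ₂) = −(2θ₂ − (θ₂⁺+θ₂⁻))/(θ₂⁺−θ₂⁻)`. -/
noncomputable def chiMap (θ2p θ2m : ℝ) (θ : ℂ) : ℂ :=
  -(2 * θ - ((θ2p : ℂ) + (θ2m : ℂ))) / ((θ2p : ℂ) - (θ2m : ℂ))

/-- The hyperbola branch `R`. -/
noncomputable def hypR (σ11 σ12 σ22 μ1 μ2 θ1m : ℝ) : Set ℂ :=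
  {z : ℂ | ∃ t : ℝ, t ≤ θ1m ∧
    (z = ((-(σ12 * t + μ2) / σ22 : ℝ) : ℂ) +
        ((Real.sqrt (-(t ^ 2 * (σ12 ^ 2 - σ11 * σ22) + 2 * t * (μ2 * σ12 - μ1 * σ22)
          + μ2 ^ 2)) / σ22 : ℝ) : ℂ) * Complex.I ∨
     z = ((-(σ12 * t + μ2) / σ22 : ℝ) : ℂ) -
        ((Real.sqrt (-(t ^ 2 * (σ12 ^ 2 - σ11 * σ22) + 2 * t * (μ2 * σ12 - μ1 * σ22)
          + μ2 ^ 2)) / σ22 : ℝ) : ℂ) * Complex.I)}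

/-- The real and imaginary parts of `cos (x + iy)`. -/
theorem cos_re_im (w : ℂ) :
    (Complex.cos w).re = Real.cos w.re * Real.cosh w.im ∧
      (Complex.cos w).im = -(Real.sin w.re * Real.sinh w.im) := by
  rw [Complex.cos_eq, ← Complex.ofReal_cos, ← Complex.ofReal_cosh, ← Complex.ofReal_sin,
    ← Complex.ofReal_sinh]
  constructor <;> simp [-Complex.ofReal_cos, -Complex.ofReal_cosh, -Complex.ofReal_sin,
    -Complex.ofReal_sinh]

theorem norm_cos_add_one (w : ℂ) :
    ‖Complex.cos w + 1‖ = Real.cosh w.im + Real.cos w.re := by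
  obtain ⟨hre, him⟩ := cos_re_im w
  have h0 : 0 ≤ Real.cosh w.im + Real.cos w.re := by
    linarith [Real.one_le_cosh w.im, Real.neg_one_le_cos w.re]
  rw [Complex.norm_eq_sqrt_sq_add_sq, Real.sqrt_eq_iff_mul_self_eq (by positivity) h0]
  simp only [Complex.add_re, Complex.add_im, Complex.one_re, Complex.one_im, hre, him]
  have h1 := Real.sin_sq_add_cos_sq w.re
  have h2 := Real.cosh_sq w.im
  have h3 : Real.sin w.re ^ 2 = 1 - Real.cos w.re ^ 2 := by linarith
  have h4 : Real.sinh w.im ^ 2 = Real.cosh w.im ^ 2 - 1 := by linarith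
  have h5 : (-(Real.sin w.re * Real.sinh w.im) + 0) ^ 2 =
      (1 - Real.cos w.re ^ 2) * (Real.cosh w.im ^ 2 - 1) := by
    rw [← h3, ← h4]; ring
  rw [h5]; ring

theorem norm_cos_sub_one (w : ℂ) :
    ‖Complex.cos w - 1‖ = Real.cosh w.im - Real.cos w.re := by
  have h := norm_cos_add_one (w + Real.pi)
  rw [Complex.cos_add_pi] at h
  have e : -Complex.cos w + 1 = -(Complex.cos w - 1) := by ring
  rw [e, norm_neg] at h
  simpa [Real.cos_add_pi, sub_eq_add_neg] using h

/-- The level sets of `‖z + 1‖ - ‖z - 1‖` are the images under `cos` of vertical lines. -/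
theorem norm_cos_add_one_sub (w : ℂ) :
    ‖Complex.cos w + 1‖ - ‖Complex.cos w - 1‖ = 2 * Real.cos w.re := by
  rw [norm_cos_add_one, norm_cos_sub_one]; ring

theorem exists_cos_eq_of_re_mem_Icc (z : ℂ) :
    ∃ w : ℂ, Complex.cos w = z ∧ 0 ≤ w.re ∧ w.re ≤ Real.pi := by
  obtain ⟨w, rfl⟩ := Complex.cos_surjective z
  obtain ⟨n, hn, -⟩ := existsUnique_add_zsmul_mem_Ioc Real.two_pi_pos w.re (-Real.pi)
  rw [zsmul_eq_mul, Set.mem_Ioc] at hn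
  set v : ℂ := w + n * (2 * Real.pi) with hv
  have hc : Complex.cos v = Complex.cos w := Complex.cos_add_int_mul_two_pi w n
  have hre : v.re = w.re + n * (2 * Real.pi) := by simp [hv]
  rcases le_total 0 v.re with h | h
  · exact ⟨v, hc, h, by linarith⟩
  · exact ⟨-v, by rw [Complex.cos_neg, hc], by simpa using h, by
      rw [Complex.neg_re]; linarith⟩

theorem cos_mem_cutC {w : ℂ} (hw : |w.re| < Real.pi) : Complex.cos w ∈ cutC := by
  rintro ⟨him, hre⟩
  obtain ⟨h1, h2⟩ := cos_re_im w
  obtain ⟨hl, hr⟩ := abs_lt.1 hw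
  have hcos : -1 < Real.cos w.re := by
    rw [← Real.cos_abs, ← Real.cos_pi]
    exact Real.cos_lt_cos_of_nonneg_of_le_pi (abs_nonneg _) le_rfl hw
  rw [h2, neg_eq_zero, mul_eq_zero] at him
  rw [h1] at hre
  rcases him with h | h
  · rw [Real.sin_eq_zero_iff_of_lt_of_lt hl hr] at h
    rw [h, Real.cos_zero] at hre
    linarith [Real.one_le_cosh w.im]
  · rw [Real.sinh_eq_zero] at h
    rw [h, Real.cosh_zero] at hre
    linarith

theorem IsChebyshev.apply_cos {a : ℝ} {T : ℂ → ℂ} (hT : IsChebyshev a T) {w : ℂ}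
    (hw : |w.re| < Real.pi) : T (Complex.cos w) = Complex.cos (a * w) := by
  set U : Set ℂ := {w : ℂ | |w.re| < Real.pi} with hU
  have hUo : IsOpen U := isOpen_lt (by fun_prop) continuous_const
  have hUc : IsPreconnected U := by
    have : U = Complex.re ⁻¹' Set.Ioo (-Real.pi) Real.pi := by
      ext z; simp [hU, abs_lt]
    rw [this]
    exact ((convex_Ioo _ _).linear_preimage Complex.reLm).isPreconnected
  have hf : AnalyticOnNhd ℂ (fun w => T (Complex.cos w)) U := by
    refine DifferentiableOn.analyticOnNhd (fun z hz => ?_) hUo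
    exact ((hT.1 _ (cos_mem_cutC hz)).comp z
      Complex.differentiable_cos.differentiableAt).differentiableWithinAt
  have hg : AnalyticOnNhd ℂ (fun w => Complex.cos (a * w)) U :=
    DifferentiableOn.analyticOnNhd (by fun_prop) hUo
  have h1 : ((1 : ℝ) : ℂ) ∈ U := by
    simp only [hU, Set.mem_ofPred_eq, Complex.ofReal_re, abs_one]
    linarith [Real.pi_gt_three]
  refine hf.eqOn_of_preconnected_of_frequently_eq hg hUc h1 ?_ hw
  have ht : Filter.Tendsto (fun x : ℝ => (x : ℂ)) (nhdsWithin 1 {1}ᶜ)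
      (nhdsWithin ((1 : ℝ) : ℂ) {((1 : ℝ) : ℂ)}ᶜ) :=
    Complex.continuous_ofReal.continuousWithinAt.tendsto_nhdsWithin
      (fun x hx => by simpa using hx)
  refine ht.frequently (Filter.Eventually.frequently ?_)
  have hn : Set.Ioo 0 Real.pi ∈ nhds (1 : ℝ) :=
    Ioo_mem_nhds one_pos (by linarith [Real.pi_gt_three])
  filter_upwards [nhdsWithin_le_nhds hn] with x hx
  have hc : -1 < Real.cos x := by
    rw [← Real.cos_pi]
    exact Real.cos_lt_cos_of_nonneg_of_le_pi hx.1.le le_rfl hx.2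
  rw [← Complex.ofReal_cos, hT.2 _ ⟨hc, Real.cos_le_one x⟩, Real.arccos_cos hx.1.le hx.2.le]
  push_cast
  rfl

/-- The generalized Chebyshev function `T_{π/β}` is injective to the right of the hyperbola
branch `‖z + 1‖ - ‖z - 1‖ = 2 cos β`. -/
theorem IsChebyshev.injOn {β : ℝ} (hβ0 : 0 < β) (hβπ : β ≤ Real.pi) {T : ℂ → ℂ}
    (hT : IsChebyshev (Real.pi / β) T) :
    Set.InjOn T {z : ℂ | 2 * Real.cos β < ‖z + 1‖ - ‖z - 1‖} := by
  have key : ∀ z : ℂ, 2 * Real.cos β < ‖z + 1‖ - ‖z - 1‖ →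
      ∃ w : ℂ, Complex.cos w = z ∧ 0 ≤ Real.pi / β * w.re ∧ Real.pi / β * w.re < Real.pi ∧
        T z = Complex.cos ((Real.pi / β : ℝ) * w) := by
    intro z hz
    obtain ⟨w, rfl, h0, h1⟩ := exists_cos_eq_of_re_mem_Icc z
    rw [norm_cos_add_one_sub] at hz
    have hlt : w.re < β := by
      by_contra! h
      linarith [Real.cos_le_cos_of_nonneg_of_le_pi hβ0.le h1 h]
    refine ⟨w, rfl, by positivity, ?_, hT.apply_cos ?_⟩
    · rw [div_mul_eq_mul_div, div_lt_iff₀ hβ0]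
      exact mul_lt_mul_of_pos_left hlt Real.pi_pos
    · rw [abs_of_nonneg h0]; linarith
  intro z hz z' hz' h
  obtain ⟨w, hw, hw0, hw1, hwT⟩ := key z hz
  obtain ⟨w', hw', hw0', hw1', hwT'⟩ := key z' hz'
  rw [hwT, hwT', Complex.cos_eq_cos_iff] at h
  have ha : ((Real.pi / β : ℝ) : ℂ) ≠ 0 := by
    exact_mod_cast (div_pos Real.pi_pos hβ0).ne'
  have hπ := Real.pi_pos
  obtain ⟨k, hk | hk⟩ := h
  · have hre := congrArg Complex.re hk
    simp only [Complex.re_ofReal_mul, Complex.add_re] at hre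
    have e : (2 * (k : ℂ) * (Real.pi : ℂ)).re = 2 * k * Real.pi := by
      simp
    rw [e] at hre
    have hk0 : k = 0 := by
      have h1 : (k : ℝ) < 1 := by nlinarith
      have h2 : (-1 : ℝ) < k := by nlinarith
      have h1' : k < 1 := by exact_mod_cast h1
      have h2' : -1 < k := by exact_mod_cast h2
      omega
    rw [hk0] at hk
    have : w' = w := mul_left_cancel₀ ha (by simpa using hk)
    rw [← hw, ← hw', this]
  · have hre := congrArg Complex.re hk
    simp only [Complex.re_ofReal_mul, Complex.sub_re] at hre
    have e : (2 * (k : ℂ) * (Real.pi : ℂ)).re = 2 * k * Real.pi := by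
      simp
    rw [e] at hre
    have hk0 : k = 0 := by
      have h1 : (k : ℝ) < 1 := by nlinarith
      have h2 : (-1 : ℝ) < k := by nlinarith
      have h1' : k < 1 := by exact_mod_cast h1
      have h2' : -1 < k := by exact_mod_cast h2
      omega
    rw [hk0] at hk
    have : w' = -w := mul_left_cancel₀ ha (by simpa using hk)
    rw [← hw, ← hw', this, Complex.cos_neg]

/-- The hyperbola branch `R`, in the normalisation `σ₁₁ = s₁²`, `σ₂₂ = s₂²`, contains every point
whose image under `χ` has the form `cos (β + iv)` with `v` real. -/
theorem mem_hypR {s1 s2 k D ρ μ1 μ2 β v : ℝ} (hs1 : 0 < s1) (hs2 : 0 < s2) (hk : 0 < k)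
    (hD : 0 < D) (hDe : D = s1 ^ 2 * s2 ^ 2 - ρ ^ 2)
    (hke : k ^ 2 = μ2 ^ 2 * s1 ^ 2 - 2 * μ1 * μ2 * ρ + μ1 ^ 2 * s2 ^ 2)
    (hcos : Real.cos β = -ρ / (s1 * s2)) {θ : ℂ}
    (hre : θ.re = (μ1 * ρ - μ2 * s1 ^ 2) / D - s1 * k / D * (Real.cos β * Real.cosh v))
    (him : θ.im = s1 * k / D * (Real.sin β * Real.sinh v)) :
    θ ∈ hypR (s1 ^ 2) ρ (s2 ^ 2) μ1 μ2 ((μ2 * ρ - μ1 * s2 ^ 2 - s2 * k) / D) := by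
  have hsin : (s1 * s2 * Real.sin β) ^ 2 = D := by
    have := Real.sin_sq_add_cos_sq β
    rw [hcos] at this
    rw [hDe]
    field_simp at this
    linarith
  set t : ℝ := (μ2 * ρ - μ1 * s2 ^ 2 - s2 * k * Real.cosh v) / D with ht
  have hx : θ.re = -(ρ * t + μ2) / s2 ^ 2 := by
    rw [hre, ht, hcos]
    field_simp
    rw [hDe]
    ring
  have hd : -(t ^ 2 * (ρ ^ 2 - s1 ^ 2 * s2 ^ 2) + 2 * t * (μ2 * ρ - μ1 * s2 ^ 2) + μ2 ^ 2) =
      (s2 ^ 2 * θ.im) ^ 2 := by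
    have e1 : (s2 ^ 2 * θ.im) ^ 2 = s2 ^ 2 * k ^ 2 / D * (Real.cosh v ^ 2 - 1) := by
      rw [him, Real.cosh_sq]
      have : (s2 ^ 2 * (s1 * k / D * (Real.sin β * Real.sinh v))) ^ 2 =
        s2 ^ 2 * k ^ 2 / D ^ 2 * (s1 * s2 * Real.sin β) ^ 2 * Real.sinh v ^ 2 := by ring
      rw [this, hsin]
      field_simp
      ring
    have e2 : ρ ^ 2 - s1 ^ 2 * s2 ^ 2 = -D := by linarith
    have e3 : s2 ^ 2 * k ^ 2 = (μ2 * ρ - μ1 * s2 ^ 2) ^ 2 + μ2 ^ 2 * D := by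
      rw [hke, hDe]; ring
    rw [e1, e2, ht]
    field_simp
    linear_combination e3
  refine ⟨t, ?_, ?_⟩
  · rw [ht]
    refine div_le_div_of_nonneg_right (sub_le_sub_left ?_ _) hD.le
    exact le_mul_of_one_le_right (by positivity) (Real.one_le_cosh v)
  · rw [hd, Real.sqrt_sq_eq_abs, abs_mul, abs_of_pos (by positivity : 0 < s2 ^ 2),
      mul_div_cancel_left₀ _ (by positivity : s2 ^ 2 ≠ 0), ← hx]
    rcases abs_choice θ.im with h | h
    · left
      rw [h, Complex.re_add_im]
    · right
      rw [h, Complex.ofReal_neg, neg_mul, sub_neg_eq_add, Complex.re_add_im]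

/-- The origin lies to the right of the hyperbola branch in the `χ` coordinate. -/
theorem cos_lt_chi_zero {s1 s2 k D ρ μ1 μ2 : ℝ} (hs1 : 0 < s1) (hs2 : 0 < s2) (hk : 0 < k)
    (hD : 0 < D) (hDe : D = s1 ^ 2 * s2 ^ 2 - ρ ^ 2) (hμ1 : μ1 < 0) (hμ2 : μ2 < 0)
    (hke : k ^ 2 = μ2 ^ 2 * s1 ^ 2 - 2 * μ1 * μ2 * ρ + μ1 ^ 2 * s2 ^ 2) :
    -ρ / (s1 * s2) < (μ1 * ρ - μ2 * s1 ^ 2) / (s1 * k) := by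
  have hs : μ2 * s1 ^ 2 < 0 := mul_neg_of_neg_of_pos hμ2 (by positivity)
  have e : (s2 * (μ1 * ρ - μ2 * s1 ^ 2)) ^ 2 - (ρ * k) ^ 2 =
      D * (μ2 * (μ2 * s1 ^ 2 - 2 * (μ1 * ρ))) := by
    rw [mul_pow ρ, hke, hDe]; ring
  have main : 0 < s2 * (μ1 * ρ - μ2 * s1 ^ 2) + ρ * k := by
    by_contra! h
    rcases le_or_gt 0 ρ with hρ | hρ
    · have h1 : 0 ≤ ρ * k := by positivity
      have h2 : μ1 * ρ - μ2 * s1 ^ 2 ≤ 0 := by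
        by_contra! h3
        have := mul_pos hs2 h3
        linarith
      have h3 : 0 ≤ D * (μ2 * (μ2 * s1 ^ 2 - 2 * (μ1 * ρ))) := by
        rw [← e]; nlinarith
      have h4 : 0 ≤ μ2 * (μ2 * s1 ^ 2 - 2 * (μ1 * ρ)) := nonneg_of_mul_nonneg_right h3 hD
      have h5 : μ2 * s1 ^ 2 - 2 * (μ1 * ρ) ≤ 0 := by
        by_contra! h6
        linarith [mul_neg_of_neg_of_pos hμ2 h6]
      linarith
    · have h1 : 0 < μ1 * ρ := mul_pos_of_neg_of_neg hμ1 hρ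
      have h2 : 0 < s2 * (μ1 * ρ - μ2 * s1 ^ 2) := mul_pos hs2 (by linarith)
      have h3 : 0 < D * (μ2 * (μ2 * s1 ^ 2 - 2 * (μ1 * ρ))) :=
        mul_pos hD (mul_pos_of_neg_of_neg hμ2 (by linarith))
      rw [← e] at h3
      nlinarith
  rw [div_lt_div_iff₀ (by positivity) (by positivity)]
  nlinarith [mul_pos hs1 main]

/-- The conformal gluing function `w = T_{π/β} ∘ χ` is injective on the domain `G_R`,
the connected component of `ℂ ∖ R` containing `0`. -/
theorem stmt11 (σ11 σ12 σ22 μ1 μ2 : ℝ)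
    (h11 : 0 < σ11) (h22 : 0 < σ22) (hdet : 0 < σ11 * σ22 - σ12 ^ 2)
    (hμ1 : μ1 < 0) (hμ2 : μ2 < 0)
    (θ1m θ2p θ2m β : ℝ)
    (hθ1m : θ1m = ((μ2 * σ12 - μ1 * σ22) -
      Real.sqrt ((μ2 * σ12 - μ1 * σ22) ^ 2 + μ2 ^ 2 * (σ11 * σ22 - σ12 ^ 2))) /
      (σ11 * σ22 - σ12 ^ 2))
    (hθ2p : θ2p = ((μ1 * σ12 - μ2 * σ11) +
      Real.sqrt ((μ1 * σ12 - μ2 * σ11) ^ 2 + μ1 ^ 2 * (σ11 * σ22 - σ12 ^ 2))) /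
      (σ11 * σ22 - σ12 ^ 2))
    (hθ2m : θ2m = ((μ1 * σ12 - μ2 * σ11) -
      Real.sqrt ((μ1 * σ12 - μ2 * σ11) ^ 2 + μ1 ^ 2 * (σ11 * σ22 - σ12 ^ 2))) /
      (σ11 * σ22 - σ12 ^ 2))
    (hβ : β = Real.arccos (-σ12 / Real.sqrt (σ11 * σ22)))
    (T : ℂ → ℂ) (hT : IsChebyshev (Real.pi / β) T) :
    Set.InjOn (fun θ => T (chiMap θ2p θ2m θ))
      (connectedComponentIn (hypR σ11 σ12 σ22 μ1 μ2 θ1m)ᶜ 0) := by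
  obtain ⟨s1, hs1, rfl⟩ : ∃ s, 0 < s ∧ s ^ 2 = σ11 :=
    ⟨√σ11, Real.sqrt_pos.2 h11, Real.sq_sqrt h11.le⟩
  obtain ⟨s2, hs2, rfl⟩ : ∃ s, 0 < s ∧ s ^ 2 = σ22 :=
    ⟨√σ22, Real.sqrt_pos.2 h22, Real.sq_sqrt h22.le⟩
  obtain ⟨D, hDe⟩ : ∃ D, D = s1 ^ 2 * s2 ^ 2 - σ12 ^ 2 := ⟨_, rfl⟩
  rw [← hDe] at hdet hθ1m hθ2p hθ2m
  obtain ⟨k, hk, hke⟩ : ∃ k, 0 < k ∧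
      k ^ 2 = μ2 ^ 2 * s1 ^ 2 - 2 * μ1 * μ2 * σ12 + μ1 ^ 2 * s2 ^ 2 := by
    have hK : 0 < μ2 ^ 2 * s1 ^ 2 - 2 * μ1 * μ2 * σ12 + μ1 ^ 2 * s2 ^ 2 := by
      have h : s1 ^ 2 * (μ2 ^ 2 * s1 ^ 2 - 2 * μ1 * μ2 * σ12 + μ1 ^ 2 * s2 ^ 2) =
          (μ2 * s1 ^ 2 - μ1 * σ12) ^ 2 + μ1 ^ 2 * D := by rw [hDe]; ring
      refine pos_of_mul_pos_right ?_ h11.le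
      rw [h]
      have : 0 < μ1 ^ 2 * D := mul_pos (by nlinarith) hdet
      positivity
    exact ⟨_, Real.sqrt_pos.2 hK, Real.sq_sqrt hK.le⟩
  have hr1 : √((μ2 * σ12 - μ1 * s2 ^ 2) ^ 2 + μ2 ^ 2 * D) = s2 * k := by
    rw [← Real.sqrt_sq (by positivity : 0 ≤ s2 * k), mul_pow, hke, hDe]
    congr 1; ring
  have hr2 : √((μ1 * σ12 - μ2 * s1 ^ 2) ^ 2 + μ1 ^ 2 * D) = s1 * k := by
    rw [← Real.sqrt_sq (by positivity : 0 ≤ s1 * k), mul_pow, hke, hDe]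
    congr 1; ring
  rw [hr1] at hθ1m
  rw [hr2] at hθ2p hθ2m
  rw [← mul_pow, Real.sqrt_sq (by positivity)] at hβ
  have hlt : |-σ12 / (s1 * s2)| < 1 := by
    rw [abs_div, abs_of_pos (by positivity : 0 < s1 * s2), div_lt_one (by positivity)]
    refine abs_lt_of_sq_lt_sq ?_ (by positivity)
    nlinarith
  obtain ⟨hlt1, hlt2⟩ := abs_lt.1 hlt
  have hcos : Real.cos β = -σ12 / (s1 * s2) := by
    rw [hβ, Real.cos_arccos hlt1.le hlt2.le]
  have hβ0 : 0 < β := hβ ▸ Real.arccos_pos.2 hlt2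
  have hβπ : β ≤ Real.pi := hβ ▸ Real.arccos_le_pi _
  have hchi : ∀ θ : ℂ, chiMap θ2p θ2m θ =
      (((μ1 * σ12 - μ2 * s1 ^ 2) / D : ℝ) - θ) / ((s1 * k / D : ℝ) : ℂ) := by
    intro θ
    have e1 : (θ2p : ℂ) + θ2m = 2 * (((μ1 * σ12 - μ2 * s1 ^ 2) / D : ℝ) : ℂ) := by
      rw [hθ2p, hθ2m]; push_cast; ring
    have e2 : (θ2p : ℂ) - θ2m = 2 * ((s1 * k / D : ℝ) : ℂ) := by
      rw [hθ2p, hθ2m]; push_cast; ring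
    rw [chiMap, e1, e2, ← mul_div_mul_left _ ((s1 * k / D : ℝ) : ℂ) (two_ne_zero' ℂ)]
    congr 1; ring
  have hr0 : ((s1 * k / D : ℝ) : ℂ) ≠ 0 := by
    exact_mod_cast (by positivity : s1 * k / D ≠ 0)
  have hchi_inj : Function.Injective (chiMap θ2p θ2m) := by
    intro θ θ' h
    rw [hchi, hchi, div_left_inj' hr0] at h
    exact sub_right_injective h
  have hmem : ∀ θ : ℂ,
      ‖chiMap θ2p θ2m θ + 1‖ - ‖chiMap θ2p θ2m θ - 1‖ = 2 * Real.cos β →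
        θ ∈ hypR (s1 ^ 2) σ12 (s2 ^ 2) μ1 μ2 θ1m := by
    intro θ h
    obtain ⟨w, hw, hw0, hw1⟩ := exists_cos_eq_of_re_mem_Icc (chiMap θ2p θ2m θ)
    rw [← hw, norm_cos_add_one_sub] at h
    have hwβ : w.re = β :=
      Real.injOn_cos ⟨hw0, hw1⟩ ⟨hβ0.le, hβπ⟩ (by linarith)
    have hθ : θ = ((μ1 * σ12 - μ2 * s1 ^ 2) / D : ℝ) - ((s1 * k / D : ℝ) : ℂ) * Complex.cos w := by
      rw [hw, hchi]
      field_simp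
      ring
    obtain ⟨hcre, hcim⟩ := cos_re_im w
    rw [hwβ] at hcre hcim
    rw [hθ1m]
    refine mem_hypR (v := w.im) hs1 hs2 hk hdet hDe hke hcos ?_ ?_
    · rw [hθ, Complex.sub_re, Complex.re_ofReal_mul, Complex.ofReal_re, hcre]
    · rw [hθ, Complex.sub_im, Complex.im_ofReal_mul, Complex.ofReal_im, hcim]
      ring
  have hzero : 2 * Real.cos β < ‖chiMap θ2p θ2m 0 + 1‖ - ‖chiMap θ2p θ2m 0 - 1‖ := by
    have h0 : chiMap θ2p θ2m 0 = (((μ1 * σ12 - μ2 * s1 ^ 2) / (s1 * k) : ℝ) : ℂ) := by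
      rw [hchi, sub_zero, ← Complex.ofReal_div, div_div_div_cancel_right₀ hdet.ne']
    have h1 := cos_lt_chi_zero hs1 hs2 hk hdet hDe hμ1 hμ2 hke
    rw [h0, ← Complex.ofReal_one, ← Complex.ofReal_add, ← Complex.ofReal_sub, Complex.norm_real,
      Complex.norm_real, Real.norm_eq_abs, Real.norm_eq_abs, hcos]
    set x := (μ1 * σ12 - μ2 * s1 ^ 2) / (s1 * k)
    rw [abs_of_pos (by linarith : 0 < x + 1)]
    rcases abs_cases (x - 1) with ⟨h, _⟩ | ⟨h, _⟩ <;> rw [h] <;> linarith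
  have hcont : Continuous fun θ : ℂ =>
      ‖chiMap θ2p θ2m θ + 1‖ - ‖chiMap θ2p θ2m θ - 1‖ := by
    simp only [hchi]
    fun_prop
  have hsub : Set.MapsTo (chiMap θ2p θ2m)
      (connectedComponentIn (hypR (s1 ^ 2) σ12 (s2 ^ 2) μ1 μ2 θ1m)ᶜ 0)
      {z : ℂ | 2 * Real.cos β < ‖z + 1‖ - ‖z - 1‖} := by
    intro θ hθ
    by_contra hle
    rw [Set.mem_ofPred_eq, not_lt] at hle
    have h0 : (0 : ℂ) ∈ connectedComponentIn (hypR (s1 ^ 2) σ12 (s2 ^ 2) μ1 μ2 θ1m)ᶜ 0 :=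
      mem_connectedComponentIn (by
        by_contra h
        rw [connectedComponentIn_eq_empty h] at hθ
        exact hθ)
    obtain ⟨p, hp, hpe⟩ := isPreconnected_connectedComponentIn.intermediate_value hθ h0
      hcont.continuousOn ⟨hle, hzero.le⟩
    exact connectedComponentIn_subset _ _ hp (hmem p hpe)
  exact (hT.injOn hβ0 hβπ).comp hchi_inj.injOn hsub
end

section
/- The Laplace transform φ₁(θ₂) = −μ₁ w′(0) θ₂/(w(θ₂) − w(0)) is an algebraic function if and only if π/β ∈ ℚ: there exists a nonzero polynomial P in two variables with complex coefficients such that P(θ₂, φ₁(θ₂)) = 0 for every θ₂ with Re θ₂ < 0 and w(θ₂) ≠ w(0), if and only if π/β is rational. -/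
open Polynomial in
/-- Functions on a set `S ⊆ ℂ` as an algebra over `ℂ[X]`, where `X` acts as the coordinate. -/
noncomputable abbrev functionAlgebra (S : Set ℂ) : Algebra ℂ[X] (S → ℂ) :=
  (RingHom.pi fun θ : S => evalRingHom (θ : ℂ)).toAlgebra

lemma functionAlgebra_algebraMap_apply (S : Set ℂ) (p : Polynomial ℂ) (θ : S) :
    letI := functionAlgebra S
    algebraMap (Polynomial ℂ) (S → ℂ) p θ = p.eval (θ : ℂ) :=
  rfl

/-- `f` satisfies a nontrivial polynomial relation with the coordinate on `S`. -/
def AlgebraicOn (S : Set ℂ) (f : ℂ → ℂ) : Prop :=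
  ∃ Q : Polynomial (Polynomial ℂ), Q ≠ 0 ∧ ∀ θ ∈ S, Q.evalEval θ (f θ) = 0

open Polynomial in
lemma functionAlgebra_aeval (S : Set ℂ) (f : ℂ → ℂ) (Q : Polynomial (Polynomial ℂ)) (θ : S) :
    letI := functionAlgebra S
    (aeval (fun θ : S => f θ) Q) θ = Q.evalEval (θ : ℂ) (f θ) := by
  let _ := functionAlgebra S
  induction Q using Polynomial.induction_on' with
  | add p q hp hq => simp [hp, hq]
  | monomial n p =>
    rw [aeval_monomial, ← C_mul_X_pow_eq_monomial]
    rw [evalEval_mul, evalEval_pow, evalEval_C, evalEval_X, Pi.mul_apply, Pi.pow_apply,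
      functionAlgebra_algebraMap_apply]

lemma algebraicOn_iff_isAlgebraic (S : Set ℂ) (f : ℂ → ℂ) :
    letI := functionAlgebra S
    AlgebraicOn S f ↔ IsAlgebraic (Polynomial ℂ) (fun θ : S => f θ) := by
  let _ := functionAlgebra S
  unfold AlgebraicOn IsAlgebraic
  refine exists_congr fun Q => and_congr_right fun _ => ⟨fun h => ?_, fun h θ hθ => ?_⟩
  · funext θ
    rw [functionAlgebra_aeval]
    exact h θ θ.2
  · rw [← functionAlgebra_aeval S f Q ⟨θ, hθ⟩, h]
    rfl

open Polynomial in
lemma evalEval_eq_eval_equivMvPolynomial (Q : Polynomial (Polynomial ℂ)) (x y : ℂ) :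
    MvPolynomial.eval ![x, y] (Bivariate.equivMvPolynomial ℂ Q) = Q.evalEval x y := by
  have : (MvPolynomial.eval ![x, y]).comp
      (Bivariate.equivMvPolynomial ℂ : ℂ[X][X] →+* MvPolynomial (Fin 2) ℂ) =
      evalEvalRingHom x y := by
    ext <;> simp
  exact congrArg (fun g => g Q) this

lemma exists_mvPolynomial_iff_algebraicOn (S : Set ℂ) (f : ℂ → ℂ) :
    (∃ P : MvPolynomial (Fin 2) ℂ, P ≠ 0 ∧ ∀ θ ∈ S, MvPolynomial.eval ![θ, f θ] P = 0) ↔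
      AlgebraicOn S f := by
  rw [← (Polynomial.Bivariate.equivMvPolynomial ℂ).toEquiv.exists_congr_right]
  simp [AlgebraicOn, evalEval_eq_eval_equivMvPolynomial]

lemma AlgebraicOn.div_sub {S : Set ℂ} {f : ℂ → ℂ} (hf : AlgebraicOn S f) (c b : ℂ)
    (hb : ∀ θ ∈ S, f θ ≠ b) : AlgebraicOn S fun θ => c * θ / (f θ - b) := by
  let _ := functionAlgebra S
  rw [algebraicOn_iff_isAlgebraic] at hf ⊢
  have hsub : IsAlgebraic (Polynomial ℂ) ((fun θ : S => f θ) - algebraMap _ _ (Polynomial.C b)) :=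
    hf.sub (isAlgebraic_algebraMap _)
  let inv : Invertible ((fun θ : S => f θ) - algebraMap _ _ (Polynomial.C b)) :=
    { invOf := fun θ => (f θ - b)⁻¹
      invOf_mul_self := by
        funext θ
        have := sub_ne_zero.2 (hb θ θ.2)
        simpa [functionAlgebra_algebraMap_apply] using inv_mul_cancel₀ this
      mul_invOf_self := by
        funext θ
        have := sub_ne_zero.2 (hb θ θ.2)
        simpa [functionAlgebra_algebraMap_apply] using mul_inv_cancel₀ this }
  have := (isAlgebraic_algebraMap (R := Polynomial ℂ) (A := S → ℂ)
    (Polynomial.C c * Polynomial.X)).mul hsub.invOf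
  refine (congrArg (IsAlgebraic (Polynomial ℂ)) (funext fun θ => ?_)).mp this
  simp only [Pi.mul_apply, functionAlgebra_algebraMap_apply, Polynomial.eval_mul,
    Polynomial.eval_C, Polynomial.eval_X, div_eq_mul_inv]
  rfl

lemma AlgebraicOn.add_const {S : Set ℂ} {f : ℂ → ℂ} (hf : AlgebraicOn S f) (b : ℂ) :
    AlgebraicOn S fun θ => f θ + b := by
  let _ := functionAlgebra S
  rw [algebraicOn_iff_isAlgebraic] at hf ⊢
  refine (congrArg (IsAlgebraic (Polynomial ℂ)) (funext fun θ => ?_)).mp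
    (hf.add (isAlgebraic_algebraMap (A := S → ℂ) (Polynomial.C b)))
  simp [functionAlgebra_algebraMap_apply]

lemma algebraicOn_div_sub_iff {S : Set ℂ} {f : ℂ → ℂ} {c b : ℂ} (hc : c ≠ 0)
    (hS : (0 : ℂ) ∉ S) (hb : ∀ θ ∈ S, f θ ≠ b) :
    AlgebraicOn S (fun θ => c * θ / (f θ - b)) ↔ AlgebraicOn S f := by
  refine ⟨fun h => ?_, fun h => h.div_sub c b hb⟩
  have hne : ∀ θ ∈ S, c * θ / (f θ - b) ≠ 0 := fun θ hθ =>
    div_ne_zero (mul_ne_zero hc (ne_of_mem_of_not_mem hθ hS)) (sub_ne_zero.2 (hb θ hθ))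
  obtain ⟨Q, hQ, hQ'⟩ := (h.div_sub c 0 hne).add_const b
  refine ⟨Q, hQ, fun θ hθ => ?_⟩
  have hθ0 : θ ≠ 0 := ne_of_mem_of_not_mem hθ hS
  have h2 := sub_ne_zero.2 (hb θ hθ)
  have : c * θ / (c * θ / (f θ - b) - 0) + b = f θ := by
    rw [sub_zero]
    field_simp
    ring
  exact this ▸ hQ' θ hθ

/-- A real number `a` is rational as soon as `cos s` and `cos (a s)` are algebraically dependent
on a nonempty real interval. -/
lemma exists_rat_of_cos_relation {a l : ℝ} (hl : 0 < l) {Q : Polynomial (Polynomial ℂ)}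
    (hQ : Q ≠ 0) (h : ∀ t ∈ Set.Ioo 0 l, Q.evalEval (Complex.cos t) (Complex.cos (a * t)) = 0) :
    ∃ q : ℚ, a = q := by
  have hall : ∀ s : ℂ, Q.evalEval (Complex.cos s) (Complex.cos (a * s)) = 0 := by
    have hd : Differentiable ℂ fun s : ℂ => Q.evalEval (Complex.cos s) (Complex.cos (a * s)) := by
      clear h hQ
      induction Q using Polynomial.induction_on' with
      | add p q hp hq =>
        simp only [Polynomial.evalEval_add]
        exact hp.add hq
      | monomial n p =>
        simp only [← Polynomial.C_mul_X_pow_eq_monomial, Polynomial.evalEval_mul,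
          Polynomial.evalEval_pow, Polynomial.evalEval_C, Polynomial.evalEval_X]
        exact (p.differentiable.comp Complex.differentiable_cos).mul (by fun_prop)
    have hfreq : ∃ᶠ s in nhdsWithin ((l / 2 : ℝ) : ℂ) {((l / 2 : ℝ) : ℂ)}ᶜ,
        Q.evalEval (Complex.cos s) (Complex.cos (a * s)) = 0 := by
      have ht : Filter.Tendsto (fun t : ℝ => (t : ℂ)) (nhdsWithin (l / 2) {l / 2}ᶜ)
          (nhdsWithin ((l / 2 : ℝ) : ℂ) {((l / 2 : ℝ) : ℂ)}ᶜ) := by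
        refine tendsto_nhdsWithin_iff.2 ⟨Complex.continuous_ofReal.continuousAt.mono_left
          nhdsWithin_le_nhds, ?_⟩
        filter_upwards [self_mem_nhdsWithin] with t ht using fun hc => ht (Complex.ofReal_injective hc)
      refine ht.frequently (Filter.Eventually.frequently ?_)
      filter_upwards [nhdsWithin_le_nhds (Ioo_mem_nhds (half_pos hl) (half_lt_self hl))] with t ht
        using h t ht
    have := AnalyticOnNhd.eqOn_zero_of_preconnected_of_frequently_eq_zero
      (hd.differentiableOn.analyticOnNhd isOpen_univ) isPreconnected_univ (Set.mem_univ _) hfreq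
    exact fun s => this (Set.mem_univ s)
  by_contra hirr
  obtain ⟨t, ht, hlead⟩ : ∃ t : ℝ, 0 < t ∧ Q.leadingCoeff.eval (Complex.cosh t) ≠ 0 := by
    by_contra! hcon
    refine Polynomial.leadingCoeff_ne_zero.2 hQ (Polynomial.eq_zero_of_infinite_isRoot _ ?_)
    refine Set.Infinite.mono (s := (fun t : ℝ => Complex.cosh t) '' Set.Ioi 0) ?_ ?_
    · rintro _ ⟨t, ht, rfl⟩
      exact hcon t ht
    · refine (Set.Ioi_infinite 0).image fun x hx y hy hxy => ?_
      have hxy : Real.cosh x = Real.cosh y := by exact_mod_cast hxy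
      exact Real.cosh_strictMonoOn.injOn (Set.Ioi_subset_Ici_self hx)
        (Set.Ioi_subset_Ici_self hy) hxy
  set R : Polynomial ℂ := Q.map (Polynomial.evalRingHom (Complex.cosh t)) with hR
  have hR0 : R ≠ 0 := fun h0 => hlead <| by
    have := congrArg (fun p => Polynomial.coeff p Q.natDegree) h0
    simpa [hR] using this
  refine hR0 (Polynomial.eq_zero_of_infinite_isRoot _ ?_)
  refine (Set.infinite_range_of_injective
    (f := fun k : ℕ => Complex.cos (a * (t * Complex.I + k * (2 * Real.pi)))) ?_).mono ?_
  · intro k m hkm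
    by_contra hne
    have hpi := Real.pi_pos
    obtain ⟨n, hn | hn⟩ := Complex.cos_eq_cos_iff.1 hkm
    · have hre := congrArg Complex.re hn
      have hre : a * (m * (2 * Real.pi)) = 2 * n * Real.pi + a * (k * (2 * Real.pi)) := by
        simpa using hre
      have h1 : a * (m - k) = n := by
        have : (2 * Real.pi) * (a * (m - k)) = (2 * Real.pi) * n := by linarith
        exact mul_left_cancel₀ (by positivity) this
      have h2 : (m : ℝ) - k ≠ 0 := sub_ne_zero.2 (by exact_mod_cast Ne.symm hne)
      exact hirr ⟨n / (m - k), by push_cast; rw [eq_div_iff h2, h1]⟩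
    · have him := congrArg Complex.im hn
      have him : a * t = -(a * t) := by simpa using him
      have ha : a = 0 := by
        have : a * t = 0 := by linarith
        exact (mul_eq_zero.1 this).resolve_right ht.ne'
      exact hirr ⟨0, by simp [ha]⟩
  · rintro _ ⟨k, rfl⟩
    have := hall (t * Complex.I + k * (2 * Real.pi))
    rw [Complex.cos_add_nat_mul_two_pi, Complex.cos_mul_I] at this
    show R.eval _ = 0
    rw [hR, ← this, Polynomial.map_evalRingHom_eval]

lemma div_sqrt_sq_add_lt {x y k : ℝ} (hk : 0 < k) (hxy : x < y) :
    x / √(x ^ 2 + k) < y / √(y ^ 2 + k) := by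
  have hx : 0 < √(x ^ 2 + k) := Real.sqrt_pos.2 (by positivity)
  have hy : 0 < √(y ^ 2 + k) := Real.sqrt_pos.2 (by positivity)
  have hx2 : √(x ^ 2 + k) ^ 2 = x ^ 2 + k := Real.sq_sqrt (by positivity)
  have hy2 : √(y ^ 2 + k) ^ 2 = y ^ 2 + k := Real.sq_sqrt (by positivity)
  rw [div_lt_div_iff₀ hx hy]
  rcases lt_or_ge x 0 with h0 | h0
  · rcases lt_or_ge y 0 with h1 | h1
    · have : -y * √(x ^ 2 + k) < -x * √(y ^ 2 + k) := by
        refine lt_of_pow_lt_pow_left₀ 2 (mul_nonneg (by linarith) hy.le) ?_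
        rw [mul_pow, mul_pow, hx2, hy2]
        nlinarith [mul_pos hk (mul_pos (sub_pos.2 hxy) (by linarith : 0 < -(x + y)))]
      linarith
    · nlinarith [mul_pos (neg_pos.2 h0) hy, mul_nonneg h1 hx.le]
  · refine lt_of_pow_lt_pow_left₀ 2 (mul_nonneg (by linarith) hx.le) ?_
    rw [mul_pow, mul_pow, hx2, hy2]
    nlinarith [mul_pos hk (mul_pos (sub_pos.2 hxy) (by linarith : 0 < x + y))]

/-- The point `χ(0)` lies strictly between `cos β` and `1`. -/
lemma chi_zero_bounds {s11 s12 s22 m1 m2 : ℝ} (h11 : 0 < s11)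
    (hdet : 0 < s11 * s22 - s12 ^ 2) (hm1 : m1 < 0) (hm2 : m2 < 0) :
    -s12 / √(s11 * s22) <
        (m1 * s12 - m2 * s11) / √((m1 * s12 - m2 * s11) ^ 2 + m1 ^ 2 * (s11 * s22 - s12 ^ 2)) ∧
      (m1 * s12 - m2 * s11) / √((m1 * s12 - m2 * s11) ^ 2 + m1 ^ 2 * (s11 * s22 - s12 ^ 2))
        < 1 := by
  have hk : 0 < m1 ^ 2 * (s11 * s22 - s12 ^ 2) := mul_pos (sq_pos_of_neg hm1) hdet
  constructor
  · have hlt : m1 * s12 < m1 * s12 - m2 * s11 := by nlinarith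
    convert div_sqrt_sq_add_lt hk hlt using 1
    have : (m1 * s12) ^ 2 + m1 ^ 2 * (s11 * s22 - s12 ^ 2) = (-m1) ^ 2 * (s11 * s22) := by ring
    rw [this, Real.sqrt_mul (sq_nonneg (-m1)), Real.sqrt_sq (neg_pos.2 hm1).le, ← neg_mul_neg m1,
      mul_div_mul_left _ _ (neg_pos.2 hm1).ne']
  · rw [div_lt_one (Real.sqrt_pos.2 (by positivity))]
    exact (le_abs_self _).trans_lt (Real.lt_sqrt (abs_nonneg _) |>.2 (by rw [sq_abs]; linarith))

lemma IsChebyshev.apply_cos_s19 {a : ℝ} {T : ℂ → ℂ} (hT : IsChebyshev a T) {t : ℝ} (h0 : 0 ≤ t)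
    (hpi : t < Real.pi) : T (Real.cos t) = Real.cos (a * t) := by
  have h := hT.2 (Real.cos t) ⟨?_, Real.cos_le_one t⟩
  · rwa [Real.arccos_cos h0 hpi.le] at h
  · rw [← Real.cos_pi]
    exact Real.cos_lt_cos_of_nonneg_of_le_pi h0 le_rfl hpi

lemma mem_cutC_of_re {z : ℂ} (hz : -1 < z.re) : z ∈ cutC := fun h => (h.2.trans_lt hz).false

lemma IsChebyshev.deriv_ne_zero {a : ℝ} {T : ℂ → ℂ} (hT : IsChebyshev a T) (ha : 0 < a) {t : ℝ}
    (h0 : 0 < t) (hpi : t < Real.pi) (hat : a * t < Real.pi) : deriv T (Real.cos t) ≠ 0 := by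
  intro hd
  have hcos : -1 < Real.cos t := by
    rw [← Real.cos_pi]
    exact Real.cos_lt_cos_of_nonneg_of_le_pi h0.le le_rfl hpi
  have hT' : HasDerivAt T 0 (Real.cos t : ℂ) := by
    rw [← hd]
    exact (hT.1 _ (mem_cutC_of_re (by rwa [Complex.ofReal_re]))).hasDerivAt
  have h1 : HasDerivAt (fun s : ℝ => T (Real.cos s)) 0 t := by
    have := HasDerivAt.comp t hT' (Real.hasDerivAt_cos t).ofReal_comp
    rwa [zero_mul] at this
  have h2 : HasDerivAt (fun s : ℝ => ((Real.cos (a * s) : ℝ) : ℂ))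
      ((-Real.sin (a * t) * a : ℝ) : ℂ) t := by
    have := (Real.hasDerivAt_cos (a * t)).comp t ((hasDerivAt_id t).const_mul a)
    simpa using this.ofReal_comp
  have h3 : HasDerivAt (fun s : ℝ => T (Real.cos s)) ((-Real.sin (a * t) * a : ℝ) : ℂ) t := by
    refine h2.congr_of_eventuallyEq ?_
    filter_upwards [Ioo_mem_nhds h0 hpi] with s hs using hT.apply_cos_s19 hs.1.le hs.2
  have h4 : -Real.sin (a * t) * a = 0 := by exact_mod_cast h3.unique h1
  have := Real.sin_pos_of_pos_of_lt_pi (mul_pos ha h0) hat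
  nlinarith [mul_pos this ha]

open Polynomial in
lemma IsChebyshev.eval_chebyshev {a : ℝ} {T : ℂ → ℂ} (hT : IsChebyshev a T) {n m : ℤ}
    (hnm : n * a = m) {z : ℂ} (hz : -1 < z.re) :
    (Chebyshev.T ℂ n).eval (T z) = (Chebyshev.T ℂ m).eval z := by
  have hopen : IsOpen {z : ℂ | -1 < z.re} := isOpen_lt continuous_const Complex.continuous_re
  have hconv : Convex ℝ {z : ℂ | -1 < z.re} := convex_halfSpace_re_gt _
  have hTd : DifferentiableOn ℂ T {z : ℂ | -1 < z.re} := fun z hz =>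
    (hT.1 z (mem_cutC_of_re hz)).differentiableWithinAt
  refine AnalyticOnNhd.eqOn_of_preconnected_of_frequently_eq (𝕜 := ℂ) (z₀ := ((0 : ℝ) : ℂ))
    (((Chebyshev.T ℂ n).differentiable.comp_differentiableOn hTd).analyticOnNhd hopen)
    ((Chebyshev.T ℂ m).differentiable.differentiableOn.analyticOnNhd hopen)
    hconv.isPreconnected (by simp) ?_ hz
  have ht : Filter.Tendsto (fun t : ℝ => (t : ℂ)) (nhdsWithin 0 {0}ᶜ)
      (nhdsWithin ((0 : ℝ) : ℂ) {((0 : ℝ) : ℂ)}ᶜ) := by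
    refine tendsto_nhdsWithin_iff.2 ⟨Complex.continuous_ofReal.continuousAt.mono_left
      nhdsWithin_le_nhds, ?_⟩
    filter_upwards [self_mem_nhdsWithin] with t ht using fun hc => ht (Complex.ofReal_injective hc)
  refine ht.frequently (Filter.Eventually.frequently ?_)
  filter_upwards [nhdsWithin_le_nhds (Ioo_mem_nhds neg_one_lt_zero zero_lt_one)] with t ht
  have h1 : T t = Complex.cos (a * Real.arccos t) := by
    rw [hT.2 t ⟨ht.1, ht.2.le⟩]
    push_cast
    rfl
  have h2 : (t : ℂ) = Complex.cos (Real.arccos t) := by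
    rw [← Complex.ofReal_cos, Real.cos_arccos ht.1.le ht.2.le]
  have h3 : (n : ℂ) * a = m := by exact_mod_cast hnm
  show (Chebyshev.T ℂ n).eval (T t) = (Chebyshev.T ℂ m).eval (t : ℂ)
  rw [h1, Chebyshev.T_complex_cos, ← mul_assoc, h3]
  conv_rhs => rw [h2, Chebyshev.T_complex_cos]

/-- The affine map `θ ↦ A - B θ`, with `A = χ(0)`, describes `chiMap`. -/
lemma chiMap_eq (p m : ℝ) (θ : ℂ) :
    chiMap p m θ = ((p + m) / (p - m) : ℝ) - (2 / (p - m) : ℝ) * θ := by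
  unfold chiMap
  push_cast
  ring

open Polynomial in
lemma algebraicOn_of_rat {a A B : ℝ} {T : ℂ → ℂ} (hT : IsChebyshev a T) {q : ℚ} (hq : a = q)
    (hA : -1 < A) (hB : 0 < B) {S : Set ℂ} (hS : ∀ θ ∈ S, θ.re < 0) :
    AlgebraicOn S fun θ => T (A - B * θ) := by
  refine ⟨(Chebyshev.T ℂ q.den).map C - C ((Chebyshev.T ℂ q.num).comp (C (A : ℂ) - C (B : ℂ) * X)),
    ?_, fun θ hθ => ?_⟩
  · intro h0
    have hdeg := congrArg natDegree (sub_eq_zero.1 h0)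
    rw [natDegree_map_eq_of_injective C_injective, natDegree_C, Chebyshev.natDegree_T] at hdeg
    simp at hdeg
  · have hre : -1 < ((A : ℂ) - B * θ).re := by
      have := mul_neg_of_pos_of_neg hB (hS θ hθ)
      simp
      linarith
    have hnm : ((q.den : ℤ) : ℝ) * a = q.num := by
      rw [hq]
      exact_mod_cast Rat.den_mul_eq_num q
    rw [evalEval_sub, evalEval_map_C, evalEval_C, hT.eval_chebyshev hnm hre]
    simp

open Polynomial in
lemma exists_rat_of_algebraicOn {a B t₀ : ℝ} {T : ℂ → ℂ} (hT : IsChebyshev a T) (ha : 0 < a)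
    (hB : 0 < B) (h0 : 0 < t₀) (hpi : t₀ < Real.pi) (hat : a * t₀ < Real.pi)
    (h : AlgebraicOn {θ | θ.re < 0 ∧ T (Real.cos t₀ - B * θ) ≠ T (Real.cos t₀)}
      fun θ => T (Real.cos t₀ - B * θ)) : ∃ q : ℚ, a = q := by
  obtain ⟨Q, hQ, hQ'⟩ := h
  set r : ℂ[X] := C (((Real.cos t₀ / B : ℝ) : ℂ)) - C ((B⁻¹ : ℝ) : ℂ) * X with hr
  have hr0 : r.natDegree ≠ 0 := by
    have hB' : ((B⁻¹ : ℝ) : ℂ) ≠ 0 := by exact_mod_cast (inv_pos.2 hB).ne'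
    rw [hr, natDegree_sub_eq_right_of_natDegree_lt] <;>
      simp only [natDegree_C_mul_X _ hB', natDegree_C] <;> norm_num
  refine exists_rat_of_cos_relation (Q := Q.map (compRingHom r)) h0 ?_ fun t ht => ?_
  · refine (Polynomial.map_ne_zero_iff fun f g hfg => ?_).2 hQ
    by_contra hne
    refine sub_ne_zero.2 hne ?_
    have : (f - g).comp r = 0 := by
      rw [sub_comp]
      exact sub_eq_zero.2 hfg
    rcases comp_eq_zero_iff.1 this with h1 | ⟨-, h1⟩
    · exact h1
    · exact absurd (by rw [h1, natDegree_C]) hr0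
  · have hθ : r.eval (Complex.cos t) = ((((Real.cos t₀ - Real.cos t) / B : ℝ)) : ℂ) := by
      simp [hr]
      ring
    have hlt : t < Real.pi := ht.2.trans hpi
    have hcos : Real.cos t₀ < Real.cos t :=
      Real.cos_lt_cos_of_nonneg_of_le_pi ht.1.le hpi.le ht.2
    have hB' : (B : ℂ) ≠ 0 := by exact_mod_cast hB.ne'
    have hchi : (Real.cos t₀ : ℂ) - B * (((Real.cos t₀ - Real.cos t) / B : ℝ) : ℂ) =
        Real.cos t := by
      push_cast
      field_simp
      ring
    have key := hQ' (((Real.cos t₀ - Real.cos t) / B : ℝ) : ℂ) ⟨?_, ?_⟩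
    · rw [← map_evalRingHom_eval, Polynomial.map_map]
      have hcomp : (evalRingHom (Complex.cos t)).comp (compRingHom r) =
          evalRingHom (r.eval (Complex.cos t)) := by
        ext <;> simp
      rw [hcomp, hθ, map_evalRingHom_eval]
      simp only [hchi, hT.apply_cos_s19 ht.1.le hlt] at key
      exact_mod_cast key
    · rw [Complex.ofReal_re]
      exact div_neg_of_neg_of_pos (by linarith) hB
    · rw [hchi, hT.apply_cos_s19 ht.1.le hlt, hT.apply_cos_s19 h0.le hpi]
      have : Real.cos (a * t₀) < Real.cos (a * t) :=
        Real.cos_lt_cos_of_nonneg_of_le_pi (mul_pos ha ht.1).le hat.le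
          (mul_lt_mul_of_pos_left ht.2 ha)
      exact_mod_cast this.ne'

/-- The Laplace transform `φ₁(θ₂) = −μ₁ w′(0) θ₂ / (w(θ₂) − w(0))` is algebraic if and
only if `π/β` is rational. -/
theorem stmt19 (σ11 σ12 σ22 μ1 μ2 : ℝ)
    (h11 : 0 < σ11) (h22 : 0 < σ22) (hdet : 0 < σ11 * σ22 - σ12 ^ 2)
    (hμ1 : μ1 < 0) (hμ2 : μ2 < 0)
    (θ2p θ2m β : ℝ)
    (hθ2p : θ2p = ((μ1 * σ12 - μ2 * σ11) +
      Real.sqrt ((μ1 * σ12 - μ2 * σ11) ^ 2 + μ1 ^ 2 * (σ11 * σ22 - σ12 ^ 2))) /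
      (σ11 * σ22 - σ12 ^ 2))
    (hθ2m : θ2m = ((μ1 * σ12 - μ2 * σ11) -
      Real.sqrt ((μ1 * σ12 - μ2 * σ11) ^ 2 + μ1 ^ 2 * (σ11 * σ22 - σ12 ^ 2))) /
      (σ11 * σ22 - σ12 ^ 2))
    (hβ : β = Real.arccos (-σ12 / Real.sqrt (σ11 * σ22)))
    (T : ℂ → ℂ) (hT : IsChebyshev (Real.pi / β) T)
    (w : ℂ → ℂ) (hw : w = fun θ => T (chiMap θ2p θ2m θ))
    (φ1 : ℂ → ℂ) (hφ1 : φ1 = fun θ => -(μ1 : ℂ) * deriv w 0 * θ / (w θ - w 0)) :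
    (∃ P : MvPolynomial (Fin 2) ℂ, P ≠ 0 ∧
        ∀ θ : ℂ, θ.re < 0 → w θ ≠ w 0 → MvPolynomial.eval ![θ, φ1 θ] P = 0) ↔
      ∃ q : ℚ, Real.pi / β = (q : ℝ) := by
  rw [show (∃ P : MvPolynomial (Fin 2) ℂ, P ≠ 0 ∧
      ∀ θ : ℂ, θ.re < 0 → w θ ≠ w 0 → MvPolynomial.eval ![θ, φ1 θ] P = 0) ↔
      AlgebraicOn {θ | θ.re < 0 ∧ w θ ≠ w 0} φ1 by
    rw [← exists_mvPolynomial_iff_algebraicOn]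
    simp]
  obtain ⟨hlow, hup⟩ := chi_zero_bounds h11 hdet hμ1 hμ2
  set b := μ1 * σ12 - μ2 * σ11 with hb
  set D := σ11 * σ22 - σ12 ^ 2 with hD
  set R := √(b ^ 2 + μ1 ^ 2 * D) with hR
  have hRpos : 0 < R := Real.sqrt_pos.2 (add_pos_of_nonneg_of_pos (sq_nonneg b)
    (mul_pos (sq_pos_of_neg hμ1) hdet))
  have hdiff : θ2p - θ2m = 2 * R / D := by rw [hθ2p, hθ2m]; ring
  have hsum : θ2p + θ2m = 2 * b / D := by rw [hθ2p, hθ2m]; ring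
  have hA : (θ2p + θ2m) / (θ2p - θ2m) = b / R := by
    rw [hdiff, hsum]
    field_simp
  have hB : 0 < 2 / (θ2p - θ2m) := by
    rw [hdiff]
    positivity
  set B := 2 / (θ2p - θ2m)
  have hcosβ : |-σ12 / √(σ11 * σ22)| < 1 := by
    have hs : 0 < √(σ11 * σ22) := Real.sqrt_pos.2 (mul_pos h11 h22)
    rw [abs_div, abs_of_pos hs, div_lt_one hs]
    exact Real.lt_sqrt (abs_nonneg _) |>.2 (by rw [sq_abs]; linarith [neg_sq σ12])
  have hlow' := (abs_lt.1 hcosβ).1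
  have hβpos : 0 < β := hβ ▸ Real.arccos_pos.2 (abs_lt.1 hcosβ).2
  have hβpi : β ≤ Real.pi := hβ ▸ Real.arccos_le_pi _
  obtain ⟨t₀, ht₀⟩ : ∃ t, t = Real.arccos (b / R) := ⟨_, rfl⟩
  have hcos : Real.cos t₀ = b / R := by
    rw [ht₀, Real.cos_arccos (hlow'.trans hlow).le hup.le]
  have h0 : 0 < t₀ := ht₀ ▸ Real.arccos_pos.2 hup
  have ht₀β : t₀ < β := by
    rw [ht₀, hβ]
    exact Real.arccos_lt_arccos hlow'.le hlow hup.le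
  have hpi : t₀ < Real.pi := ht₀β.trans_le hβpi
  have ha : 0 < Real.pi / β := div_pos Real.pi_pos hβpos
  have hat : Real.pi / β * t₀ < Real.pi := by
    rw [div_mul_eq_mul_div, div_lt_iff₀ hβpos]
    exact mul_lt_mul_of_pos_left ht₀β Real.pi_pos
  have hw' : w = fun θ => T (Real.cos t₀ - B * θ) := by
    rw [hw]
    funext θ
    rw [chiMap_eq, hA, hcos]
  have hw0 : w 0 = T (Real.cos t₀) := by simp [hw']
  have hmem : ((Real.cos t₀ : ℝ) : ℂ) ∈ cutC := mem_cutC_of_re <| by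
    rw [Complex.ofReal_re, hcos]
    exact hlow'.trans hlow
  have hderiv : deriv w 0 ≠ 0 := by
    have haff : HasDerivAt (fun θ : ℂ => (Real.cos t₀ : ℂ) - B * θ) (-B) 0 := by
      simpa using ((hasDerivAt_id (0 : ℂ)).const_mul (B : ℂ)).const_sub (Real.cos t₀ : ℂ)
    have hTd : HasDerivAt T (deriv T (Real.cos t₀)) ((Real.cos t₀ : ℂ) - B * 0) := by
      rw [mul_zero, sub_zero]
      exact (hT.1 _ hmem).hasDerivAt
    have : HasDerivAt w (deriv T (Real.cos t₀) * -B) 0 := hw' ▸ hTd.comp 0 haff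
    rw [this.deriv]
    exact mul_ne_zero (hT.deriv_ne_zero ha h0 hpi hat)
      (neg_ne_zero.2 (Complex.ofReal_ne_zero.2 hB.ne'))
  have hc : -(μ1 : ℂ) * deriv w 0 ≠ 0 :=
    mul_ne_zero (neg_ne_zero.2 (Complex.ofReal_ne_zero.2 hμ1.ne)) hderiv
  rw [hφ1, algebraicOn_div_sub_iff hc (fun h => by simp at h) fun θ hθ => hθ.2, hw0]
  rw [hw']
  refine ⟨exists_rat_of_algebraicOn hT ha hB h0 hpi hat, fun ⟨q, hq⟩ => ?_⟩
  exact algebraicOn_of_rat hT hq (by rw [hcos]; exact hlow'.trans hlow) hB fun θ hθ => hθ.1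
end
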